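/- arXiv:2010.02709 — 7 statements merged into one kernel-verified Lean document; each statement's English description precedes it below -/
import Mathlib

section
/- Let c_min < c_max be real numbers, σ² > 0, and for each integer D ≥ 2 put c_i := c_min + ((i − 1)/(D − 1))(c_max − c_min) for i = 1, …, D. Then for all x, x' ∈ [c_min, c_max], the sequence σ² ((c_max − c_min)/D) Σ_{i=1}^D ReLU(x; c_i) ReLU(x'; c_i) converges as D → ∞ to σ² H(x̄ − c_min) [ (1/3)(x̄³ − c_min³) − (1/2)(x̄² − c_min²)(x + x') + (x̄ − c_min) x x' ], where x̄ := min(x, x'). -/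
open Filter

/-- Heaviside function: `H t = 1` if `t ≥ 0`, else `0`. -/
noncomputable def heaviside (t : ℝ) : ℝ := if 0 ≤ t then 1 else 0

/-- Generalized ReLU: `ReLU(z; c) = max (0, z - c)`. -/
noncomputable def genRelu (z c : ℝ) : ℝ := max 0 (z - c)

open Filter Topology Finset in
/-- Riemann sums over the `n + 1` equally spaced nodes of `[a, b]`, endpoints included, of an
antitone function converge to its integral. -/
theorem AntitoneOn.tendsto_riemann_sum {g : ℝ → ℝ} {a b : ℝ} (hab : a ≤ b)
    (hg : AntitoneOn g (Set.Icc a b)) :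
    Tendsto (fun n : ℕ => (b - a) / n * ∑ i ∈ range (n + 1), g (a + (i / n) * (b - a)))
      atTop (𝓝 (∫ t in a..b, g t)) := by
  have hstep (c : ℝ) :
      Tendsto (fun n : ℕ => (∫ t in a..b, g t) + (b - a) / n * c) atTop
        (𝓝 (∫ t in a..b, g t)) := by
    have h := ((tendsto_const_div_atTop_nhds_zero_nat (b - a)).mul_const c).const_add
      (∫ t in a..b, g t)
    simpa using h
  have key (n : ℕ) (hn : 0 < n) :
      (∫ t in a..b, g t) + (b - a) / n * g b ≤
          (b - a) / n * ∑ i ∈ range (n + 1), g (a + (i / n) * (b - a)) ∧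
        (b - a) / n * ∑ i ∈ range (n + 1), g (a + (i / n) * (b - a)) ≤
          (∫ t in a..b, g t) + (b - a) / n * g a := by
    have hn' : (0 : ℝ) < n := by exact_mod_cast hn
    have hba : 0 ≤ b - a := sub_nonneg.2 hab
    have hh : 0 ≤ (b - a) / n := by positivity
    let f : ℝ → ℝ := fun t => g (a + (b - a) / n * t)
    have hf : AntitoneOn f (Set.Icc (0 : ℝ) (0 + (n : ℕ))) := by
      have hmem (t : ℝ) (ht : t ∈ Set.Icc (0 : ℝ) (0 + (n : ℕ))) :
          a + (b - a) / n * t ∈ Set.Icc a b := by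
        have h1 : (b - a) / n * t ≤ (b - a) / n * n :=
          mul_le_mul_of_nonneg_left (by simpa using ht.2) hh
        rw [div_mul_cancel₀ _ hn'.ne'] at h1
        exact ⟨by linarith [mul_nonneg hh ht.1], by linarith⟩
      intro s hs t ht hst
      exact hg (hmem s hs) (hmem t ht) (by gcongr)
    have hint : (b - a) / n * ∫ t in (0 : ℝ)..(0 + (n : ℕ)), f t = ∫ t in a..b, g t := by
      have h := intervalIntegral.smul_integral_comp_add_mul (a := 0) (b := 0 + (n : ℝ)) g
        ((b - a) / n) a
      rw [smul_eq_mul] at h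
      rw [h]
      congr 1
      · ring
      · field_simp
        ring
    have hterm (i : ℕ) : g (a + (i / n) * (b - a)) = f i := by
      simp only [f]
      congr 1
      ring
    have hfn : f n = g b := by
      simp only [f]
      rw [div_mul_cancel₀ _ hn'.ne']
      congr 1
      ring
    have hf0 : f 0 = g a := by simp [f]
    have hlow := mul_le_mul_of_nonneg_left hf.integral_le_sum hh
    have hupp := mul_le_mul_of_nonneg_left hf.sum_le_integral hh
    rw [hint] at hlow hupp
    simp only [zero_add] at hlow hupp
    simp only [hterm]
    constructor
    · rw [sum_range_succ, mul_add, hfn]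
      linarith
    · rw [sum_range_succ', mul_add, Nat.cast_zero, hf0]
      linarith
  refine tendsto_of_tendsto_of_tendsto_of_le_of_le' (hstep (g b)) (hstep (g a)) ?_ ?_
  · filter_upwards [eventually_gt_atTop 0] with n hn using (key n hn).1
  · filter_upwards [eventually_gt_atTop 0] with n hn using (key n hn).2

theorem genRelu_nonneg (z c : ℝ) : 0 ≤ genRelu z c := le_max_left _ _

theorem antitone_genRelu (z : ℝ) : Antitone (genRelu z) := fun _ _ h =>
  max_le_max_left 0 (sub_le_sub_left h z)

theorem antitone_genRelu_mul (x y : ℝ) : Antitone fun c => genRelu x c * genRelu y c :=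
  fun _ _ h => mul_le_mul (antitone_genRelu x h) (antitone_genRelu y h) (genRelu_nonneg _ _)
    (genRelu_nonneg _ _)

theorem integral_genRelu_mul {a b x y : ℝ} (ha : a ≤ min x y) (hb : min x y ≤ b) :
    ∫ c in a..b, genRelu x c * genRelu y c =
      (1 / 3) * ((min x y) ^ 3 - a ^ 3) - (1 / 2) * ((min x y) ^ 2 - a ^ 2) * (x + y)
        + (min x y - a) * x * y := by
  have hi (s t : ℝ) : IntervalIntegrable (fun c => genRelu x c * genRelu y c)
      MeasureTheory.volume s t := (antitone_genRelu_mul x y).intervalIntegrable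
  rw [← intervalIntegral.integral_add_adjacent_intervals (hi a (min x y)) (hi (min x y) b)]
  have hright : ∫ c in (min x y)..b, genRelu x c * genRelu y c = 0 := by
    rw [intervalIntegral.integral_congr (g := fun _ => (0 : ℝ))]
    · simp
    · intro c hc
      rw [Set.uIcc_of_le hb] at hc
      rcases min_le_iff.1 hc.1 with h | h
      · simp [genRelu, max_eq_left (sub_nonpos.2 h)]
      · simp [genRelu, max_eq_left (sub_nonpos.2 h)]
  have hleft : ∫ c in a..(min x y), genRelu x c * genRelu y c =
      ∫ c in a..(min x y), (x - c) * (y - c) := by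
    refine intervalIntegral.integral_congr fun c hc => ?_
    rw [Set.uIcc_of_le ha] at hc
    obtain ⟨hcx, hcy⟩ := le_min_iff.1 hc.2
    simp [genRelu, max_eq_right (sub_nonneg.2 hcx), max_eq_right (sub_nonneg.2 hcy)]
  have hderiv (c : ℝ) : HasDerivAt
      (fun c => (1 / 3) * c ^ 3 - (1 / 2) * c ^ 2 * (x + y) + c * x * y)
      ((x - c) * (y - c)) c := by
    have h := ((((hasDerivAt_pow 3 c).const_mul (1 / 3)).sub
      (((hasDerivAt_pow 2 c).const_mul (1 / 2)).mul_const (x + y))).add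
      (((hasDerivAt_id c).mul_const x).mul_const y))
    refine h.congr_deriv ?_
    push_cast
    ring
  rw [hright, hleft, intervalIntegral.integral_eq_sub_of_hasDerivAt (fun c _ => hderiv c)
    (Continuous.intervalIntegrable (by fun_prop) _ _)]
  ring

/-- The Riemann sums `σ² ((c_max − c_min)/D) Σ_{i=1}^D ReLU(x; c_i) ReLU(x'; c_i)`,
with `c_i := c_min + ((i − 1)/(D − 1))(c_max − c_min)`, converge as `D → ∞` to the cubic
spline kernel
`σ² H(x̄ − c_min) [(1/3)(x̄³ − c_min³) − (1/2)(x̄² − c_min²)(x + x') + (x̄ − c_min) x x']`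
for all `x, x' ∈ [c_min, c_max]`, where `x̄ = min(x, x')`. -/
theorem riemann_sum_tendsto_cubic_spline (cmin cmax σ2 : ℝ) (hc : cmin < cmax) (hσ : 0 < σ2)
    (x x' : ℝ) (hx : x ∈ Set.Icc cmin cmax) (hx' : x' ∈ Set.Icc cmin cmax) :
    Tendsto
      (fun D : ℕ =>
        σ2 * ((cmax - cmin) / D) *
          ∑ i ∈ Finset.Icc 1 D,
            genRelu x (cmin + (((i : ℝ) - 1) / ((D : ℝ) - 1)) * (cmax - cmin)) *
              genRelu x' (cmin + (((i : ℝ) - 1) / ((D : ℝ) - 1)) * (cmax - cmin)))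
      atTop
      (nhds (σ2 * heaviside (min x x' - cmin) *
        ((1 / 3) * ((min x x') ^ 3 - cmin ^ 3)
          - (1 / 2) * ((min x x') ^ 2 - cmin ^ 2) * (x + x')
          + (min x x' - cmin) * x * x'))) := by
  have ha : cmin ≤ min x x' := le_min hx.1 hx'.1
  have hb : min x x' ≤ cmax := (min_le_left _ _).trans hx.2
  have hH : heaviside (min x x' - cmin) = 1 := if_pos (sub_nonneg.2 ha)
  rw [hH, mul_one, ← integral_genRelu_mul ha hb, ← tendsto_add_atTop_iff_nat 1]
  have hsum := ((antitone_genRelu_mul x x').antitoneOn (Set.Icc cmin cmax)).tendsto_riemann_sum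
    hc.le
  have h := (hsum.const_mul σ2).mul (tendsto_natCast_div_add_atTop (1 : ℝ))
  rw [mul_one] at h
  refine h.congr' ?_
  filter_upwards [eventually_gt_atTop 0] with n hn
  have hn' : (n : ℝ) ≠ 0 := by exact_mod_cast hn.ne'
  have hn1 : (n : ℝ) + 1 ≠ 0 := by positivity
  rw [← Finset.Ico_add_one_right_eq_Icc, Finset.sum_Ico_eq_sum_range]
  simp only [Nat.add_sub_cancel, Nat.cast_add, Nat.cast_one, add_sub_cancel_left,
    add_sub_cancel_right]
  field_simp
end

section
/- For all real numbers x, x', c_min and σ² > 0, the cubic spline kernel admits the integral representation k¹(x, x'; c_min, σ²) = σ² ∫_{c_min}^{∞} ReLU(x; c) ReLU(x'; c) dc, where the integrand is compactly supported (it vanishes for c ≥ min(x, x')), so the improper integral converges. -/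
open MeasureTheory

/-- The cubic spline kernel `k¹(x, x'; c_min, σ²)`. -/
noncomputable def cubicSplineKernel (x x' cmin σ2 : ℝ) : ℝ :=
  σ2 * heaviside (min x x' - cmin) *
    ((1 / 3) * ((min x x') ^ 3 - cmin ^ 3)
      - (1 / 2) * ((min x x') ^ 2 - cmin ^ 2) * (x + x')
      + (min x x' - cmin) * x * x')

lemma continuous_genRelu_mul (x x' : ℝ) :
    Continuous fun c : ℝ => genRelu x c * genRelu x' c := by
  unfold genRelu
  fun_prop

lemma genRelu_of_le {z c : ℝ} (h : z ≤ c) : genRelu z c = 0 :=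
  max_eq_left (sub_nonpos.mpr h)

lemma genRelu_of_ge {z c : ℝ} (h : c ≤ z) : genRelu z c = z - c :=
  max_eq_right (sub_nonneg.mpr h)

lemma genRelu_mul_eq_zero {x x' c : ℝ} (h : min x x' ≤ c) :
    genRelu x c * genRelu x' c = 0 := by
  rcases min_le_iff.mp h with h | h <;> simp [genRelu_of_le h]

lemma integral_sub_mul_sub (x x' a b : ℝ) :
    ∫ c in a..b, (x - c) * (x' - c)
      = (1 / 3) * (b ^ 3 - a ^ 3) - (1 / 2) * (b ^ 2 - a ^ 2) * (x + x') + (b - a) * x * x' := by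
  have hderiv : ∀ c ∈ Set.uIcc a b, HasDerivAt
      (fun c : ℝ => c ^ 3 / 3 - c ^ 2 / 2 * (x + x') + c * (x * x')) ((x - c) * (x' - c)) c := by
    intro c _
    refine ((((hasDerivAt_pow 3 c).div_const 3).sub
      (((hasDerivAt_pow 2 c).div_const 2).mul_const (x + x'))).add
      ((hasDerivAt_id c).mul_const (x * x'))).congr_deriv ?_
    norm_num
    ring
  rw [intervalIntegral.integral_eq_sub_of_hasDerivAt hderiv
    (Continuous.intervalIntegrable (by fun_prop) a b)]
  ring

lemma setIntegral_Ioi_genRelu_mul (x x' a : ℝ) :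
    ∫ c in Set.Ioi a, genRelu x c * genRelu x' c
      = ∫ c in Set.Ioc a (min x x'), genRelu x c * genRelu x' c :=
  setIntegral_eq_of_subset_of_forall_sdiff_eq_zero measurableSet_Ioi Set.Ioc_subset_Ioi_self
    fun _ hc => genRelu_mul_eq_zero (not_le.mp fun h => hc.2 ⟨hc.1, h⟩).le

lemma integrableOn_Ioi_genRelu_mul (x x' a : ℝ) :
    IntegrableOn (fun c : ℝ => genRelu x c * genRelu x' c) (Set.Ioi a) :=
  (continuous_genRelu_mul x x').integrableOn_Ioc.of_forall_sdiff_eq_zero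
    (s := Set.Ioc a (min x x')) measurableSet_Ioi
    fun _ hc => genRelu_mul_eq_zero (not_le.mp fun h => hc.2 ⟨hc.1, h⟩).le

/-- The cubic spline kernel admits the integral representation
`k¹(x, x'; c_min, σ²) = σ² ∫_{c_min}^{∞} ReLU(x; c) ReLU(x'; c) dc`; the integrand
vanishes for `c ≥ min(x, x')`, and the improper integral converges. -/
theorem cubicSplineKernel_eq_integral (x x' cmin σ2 : ℝ) (hσ : 0 < σ2) :
    (∀ c : ℝ, min x x' ≤ c → genRelu x c * genRelu x' c = 0) ∧
    IntegrableOn (fun c : ℝ => genRelu x c * genRelu x' c) (Set.Ioi cmin) ∧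
    cubicSplineKernel x x' cmin σ2
      = σ2 * ∫ c in Set.Ioi cmin, genRelu x c * genRelu x' c := by
  refine ⟨fun c hc => genRelu_mul_eq_zero hc, integrableOn_Ioi_genRelu_mul x x' cmin, ?_⟩
  rw [setIntegral_Ioi_genRelu_mul, cubicSplineKernel, mul_assoc]
  congr 1
  rcases le_or_gt cmin (min x x') with h | h
  · have hcongr : ∫ c in Set.Ioc cmin (min x x'), genRelu x c * genRelu x' c
        = ∫ c in Set.Ioc cmin (min x x'), (x - c) * (x' - c) :=
      setIntegral_congr_fun measurableSet_Ioc fun c hc => by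
        simp only [genRelu_of_ge (hc.2.trans (min_le_left x x')),
          genRelu_of_ge (hc.2.trans (min_le_right x x'))]
    rw [hcongr, ← intervalIntegral.integral_of_le h, integral_sub_mul_sub, heaviside,
      if_pos (sub_nonneg.mpr h), one_mul]
  · rw [Set.Ioc_eq_empty h.not_gt, setIntegral_empty, heaviside,
      if_neg (not_le.mpr (sub_neg.mpr h)), zero_mul]
end

section
/- For every c_min ∈ ℝ and σ² > 0, the cubic spline kernel k¹(·, ·; c_min, σ²) is a positive semidefinite kernel on ℝ: for every n ∈ ℕ, every x_1, …, x_n ∈ ℝ and every a_1, …, a_n ∈ ℝ, Σ_{i=1}^n Σ_{j=1}^n a_i a_j k¹(x_i, x_j; c_min, σ²) ≥ 0. -/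
/-- The cubic spline kernel as an `L²` inner product of truncated linear functions. -/
lemma cubicSplineKernel_eq_integral_s4 {x y c M : ℝ} (σ2 : ℝ) (hc : c ≤ M) (hx : x ≤ M) :
    cubicSplineKernel x y c σ2 = σ2 * ∫ t in c..M, max (x - t) 0 * max (y - t) 0 := by
  have integral_eq_zero : ∀ b, min x y ≤ b → b ≤ M →
      ∫ t in b..M, max (x - t) 0 * max (y - t) 0 = 0 := by
    intro b hb hbM
    rw [← intervalIntegral.integral_zero (a := b) (b := M) (μ := MeasureTheory.volume)]
    refine intervalIntegral.integral_congr fun t ht => ?_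
    rw [Set.uIcc_of_le hbM] at ht
    rcases min_le_iff.1 (hb.trans ht.1) with h | h <;> simp [h]
  rcases lt_or_ge (min x y) c with h | h
  · rw [integral_eq_zero c h.le hc, cubicSplineKernel, heaviside, if_neg (by linarith)]
    simp
  · have hcont : Continuous fun t : ℝ => max (x - t) 0 * max (y - t) 0 := by fun_prop
    rw [← intervalIntegral.integral_add_adjacent_intervals
      (hcont.intervalIntegrable c (min x y)) (hcont.intervalIntegrable (min x y) M),
      integral_eq_zero _ le_rfl (min_le_of_left_le hx), add_zero]
    have integral_eq : ∫ t in c..min x y, max (x - t) 0 * max (y - t) 0 =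
        ∫ t in c..min x y, (t ^ 2 - (x + y) * t + x * y) := by
      refine intervalIntegral.integral_congr fun t ht => ?_
      rw [Set.uIcc_of_le h] at ht
      obtain ⟨htx, hty⟩ := le_min_iff.1 ht.2
      simp only [max_eq_left (sub_nonneg.2 htx), max_eq_left (sub_nonneg.2 hty)]
      ring
    rw [integral_eq, intervalIntegral.integral_add
        (Continuous.intervalIntegrable (by fun_prop) _ _)
        (Continuous.intervalIntegrable (by fun_prop) _ _),
      intervalIntegral.integral_sub
        (Continuous.intervalIntegrable (by fun_prop) _ _)
        (Continuous.intervalIntegrable (by fun_prop) _ _),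
      intervalIntegral.integral_const_mul, integral_pow, integral_id,
      intervalIntegral.integral_const, cubicSplineKernel, heaviside,
      if_pos (sub_nonneg.2 h), smul_eq_mul]
    push_cast
    ring

/-- The cubic spline kernel is a positive semidefinite kernel on `ℝ`: for every `n`,
points `x_1, …, x_n` and coefficients `a_1, …, a_n`,
`Σ_i Σ_j a_i a_j k¹(x_i, x_j; c_min, σ²) ≥ 0`. -/
theorem cubicSplineKernel_posSemidef (cmin σ2 : ℝ) (hσ : 0 < σ2)
    (n : ℕ) (x : Fin n → ℝ) (a : Fin n → ℝ) :
    0 ≤ ∑ i : Fin n, ∑ j : Fin n, a i * a j * cubicSplineKernel (x i) (x j) cmin σ2 := by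
  obtain ⟨B, hB⟩ := (Set.finite_range x).bddAbove
  have hx : ∀ i, x i ≤ max cmin B := fun i => (hB ⟨i, rfl⟩).trans (le_max_right _ _)
  have sum_eq : ∑ i, ∑ j, a i * a j * cubicSplineKernel (x i) (x j) cmin σ2 =
      σ2 * ∫ t in cmin..max cmin B, (∑ i, a i * max (x i - t) 0) ^ 2 := by
    simp only [sq, Finset.sum_mul_sum]
    rw [intervalIntegral.integral_finsetSum fun i _ =>
      Continuous.intervalIntegrable (by fun_prop) _ _, Finset.mul_sum]
    refine Finset.sum_congr rfl fun i _ => ?_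
    rw [intervalIntegral.integral_finsetSum fun j _ =>
      Continuous.intervalIntegrable (by fun_prop) _ _, Finset.mul_sum]
    refine Finset.sum_congr rfl fun j _ => ?_
    rw [cubicSplineKernel_eq_integral_s4 σ2 (le_max_left _ _) (hx i), mul_left_comm,
      ← intervalIntegral.integral_const_mul]
    simp only [mul_mul_mul_comm]
  rw [sum_eq]
  exact mul_nonneg hσ.le
    (intervalIntegral.integral_nonneg (le_max_left _ _) fun t _ => sq_nonneg _)
end

section
/- The multivariate DSCS kernel is positively homogeneous of degree three: for every N ≥ 1, σ² > 0, every x, x' ∈ ℝ^N and every scalar α ≥ 0, k_↔(α x, α x'; σ²) = α³ k_↔(x, x'; σ²). -/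
/-- `k¹_→(x, x'; σ²) := k¹(x, x'; 0, σ²)`. -/
noncomputable def kRight (x x' σ2 : ℝ) : ℝ := cubicSplineKernel x x' 0 σ2

/-- `k¹_←(x, x'; σ²) := k¹_→(−x, −x'; σ²)`. -/
noncomputable def kLeft (x x' σ2 : ℝ) : ℝ := kRight (-x) (-x') σ2

/-- The one-dimensional double-sided cubic spline (DSCS) kernel. -/
noncomputable def dscs1 (x x' σ2 : ℝ) : ℝ := kLeft x x' σ2 + kRight x x' σ2

/-- The multivariate DSCS kernel `k_↔(x, x'; σ²) := (1/N) Σ_{i=1}^N k¹_↔(x_i, x'_i; σ²)`. -/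
noncomputable def dscs {N : ℕ} (x x' : Fin N → ℝ) (σ2 : ℝ) : ℝ :=
  (1 / N) * ∑ i : Fin N, dscs1 (x i) (x' i) σ2

theorem heaviside_mul_of_pos {a : ℝ} (ha : 0 < a) (t : ℝ) : heaviside (a * t) = heaviside t := by
  simp only [heaviside, mul_nonneg_iff_of_pos_left ha]

/-- Scaling both arguments and the left endpoint scales the cubic spline kernel cubically. -/
theorem cubicSplineKernel_mul {a : ℝ} (ha : 0 ≤ a) (x y c s : ℝ) :
    cubicSplineKernel (a * x) (a * y) (a * c) s = a ^ 3 * cubicSplineKernel x y c s := by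
  rcases ha.eq_or_lt with rfl | ha
  · simp [cubicSplineKernel]
  · simp only [cubicSplineKernel, ← mul_min_of_nonneg x y ha.le, ← mul_sub,
      heaviside_mul_of_pos ha]
    ring

theorem kRight_mul {a : ℝ} (ha : 0 ≤ a) (x y s : ℝ) :
    kRight (a * x) (a * y) s = a ^ 3 * kRight x y s := by
  simpa [kRight] using cubicSplineKernel_mul ha x y 0 s

theorem dscs1_mul {a : ℝ} (ha : 0 ≤ a) (x y s : ℝ) :
    dscs1 (a * x) (a * y) s = a ^ 3 * dscs1 x y s := by
  simp only [dscs1, kLeft, ← mul_neg, kRight_mul ha, mul_add]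

/-- The multivariate DSCS kernel is positively homogeneous of degree three:
for `α ≥ 0`, `k_↔(α x, α x'; σ²) = α³ k_↔(x, x'; σ²)`. -/
theorem dscs_homogeneous {N : ℕ} (hN : 1 ≤ N) (σ2 : ℝ) (hσ : 0 < σ2)
    (x x' : Fin N → ℝ) (α : ℝ) (hα : 0 ≤ α) :
    dscs (α • x) (α • x') σ2 = α ^ 3 * dscs x x' σ2 := by
  simp only [dscs, Pi.smul_apply, smul_eq_mul, dscs1_mul hα, ← Finset.mul_sum]
  ring
end

section
/- For every σ² > 0 and all real numbers x, x' with x x' ≤ 0 (i.e., x and x' have opposite signs or one of them is zero), the one-dimensional DSCS kernel vanishes: k¹_↔(x, x'; σ²) = 0. -/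
/-- The right-sided kernel vanishes at points of opposite signs. -/
theorem kRight_eq_zero_of_mul_nonpos (σ2 : ℝ) {x x' : ℝ} (h : x * x' ≤ 0) :
    kRight x x' σ2 = 0 := by
  have hmin : min x x' ≤ 0 := by
    by_contra! hpos
    obtain ⟨hx, hx'⟩ := lt_min_iff.mp hpos
    exact (mul_pos hx hx').not_ge h
  rcases hmin.lt_or_eq with hneg | hzero
  · simp only [kRight, cubicSplineKernel, heaviside, sub_zero, if_neg hneg.not_ge,
      mul_zero, zero_mul]
  · simp [kRight, cubicSplineKernel, hzero]

/-- If `x x' ≤ 0` then the one-dimensional DSCS kernel vanishes: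
`k¹_↔(x, x'; σ²) = 0`. -/
theorem dscs1_eq_zero_of_opposite_signs (σ2 : ℝ) (hσ : 0 < σ2) (x x' : ℝ)
    (h : x * x' ≤ 0) : dscs1 x x' σ2 = 0 := by
  rw [dscs1, kLeft, kRight_eq_zero_of_mul_nonpos σ2 h,
    kRight_eq_zero_of_mul_nonpos σ2 (by rwa [neg_mul_neg]), add_zero]
end

section
/- (Uniform Asymptotic Confidence, analytic core) Let C ≥ 1 be an integer. For each i = 1, …, C let a_i, b_i ∈ ℝ and let v_i: (0, ∞) → ℝ satisfy v_i(α) ≥ 0 for all large α and v_i(α)/α³ → c_i as α → ∞ with c_i > 0. Define m_i(α) := a_i α + b_i and κ_i(α) := (1 + (π/8) v_i(α))^{−1/2}. Then for every class index c ∈ {1, …, C}, the generalized probit softmax probability exp(m_c(α) κ_c(α)) / Σ_{i=1}^C exp(m_i(α) κ_i(α)) converges to 1/C as α → ∞. -/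
open Filter Real

/-- An affine function is negligible against the square root of a function of cubic growth. -/
theorem tendsto_affine_mul_rpow_neg_half_of_cubic {a b c : ℝ} {v : ℝ → ℝ} (hc : 0 < c)
    (hv_nonneg : ∀ᶠ α in atTop, 0 ≤ v α)
    (hv_lim : Tendsto (fun α => v α / α ^ 3) atTop (nhds c)) :
    Tendsto (fun α => (a * α + b) * (1 + π / 8 * v α) ^ (-(1 : ℝ) / 2)) atTop (nhds 0) := by
  have affine_lim : Tendsto (fun α : ℝ => a * α ^ (-(1 / 2) : ℝ) + b * α ^ (-(3 / 2) : ℝ))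
      atTop (nhds 0) := by
    simpa using ((tendsto_rpow_neg_atTop (y := 1 / 2) (by norm_num)).const_mul a).add
      ((tendsto_rpow_neg_atTop (y := 3 / 2) (by norm_num)).const_mul b)
  have base_lim : Tendsto (fun α : ℝ => (α ^ 3)⁻¹ + π / 8 * (v α / α ^ 3))
      atTop (nhds (π / 8 * c)) := by
    simpa using (tendsto_inv_atTop_zero.comp (tendsto_pow_atTop (α := ℝ) (n := 3)
      (by norm_num))).add (hv_lim.const_mul (π / 8))
  have base_ne : π / 8 * c ≠ 0 := by positivity
  have prod_lim := affine_lim.mul (base_lim.rpow_const (p := -(1 : ℝ) / 2) (Or.inl base_ne))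
  rw [zero_mul] at prod_lim
  refine prod_lim.congr' ?_
  filter_upwards [hv_nonneg, eventually_gt_atTop 0] with α hv hα
  have base_eq : 1 + π / 8 * v α = α ^ 3 * ((α ^ 3)⁻¹ + π / 8 * (v α / α ^ 3)) := by
    field_simp
  have pow_eq : (α ^ 3) ^ (-(1 : ℝ) / 2) = α ^ (-(3 / 2) : ℝ) := by
    rw [← rpow_natCast, ← rpow_mul hα.le]
    norm_num
  have half_eq : α ^ (-(1 / 2) : ℝ) = α * α ^ (-(3 / 2) : ℝ) := by
    rw [← rpow_one_add' hα.le (by norm_num)]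
    norm_num
  rw [base_eq, mul_rpow (by positivity) (by positivity), pow_eq, half_eq]
  ring

/-- (Uniform Asymptotic Confidence, analytic core) Let `C ≥ 1`. For each `i` let
`m_i(α) := a_i α + b_i`, let `v_i(α) ≥ 0` for large `α` with `v_i(α)/α³ → c_i > 0`,
and `κ_i(α) := (1 + (π/8) v_i(α))^{-1/2}`. Then for every class `c`, the generalized
probit softmax probability `exp(m_c κ_c) / Σ_i exp(m_i κ_i)` tends to `1/C`. -/
theorem uniform_asymptotic_confidence {C : ℕ} (hC : 1 ≤ C)
    (a b : Fin C → ℝ) (v : Fin C → ℝ → ℝ) (c : Fin C → ℝ)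
    (hc : ∀ i, 0 < c i)
    (hv_nonneg : ∀ i, ∀ᶠ α in atTop, 0 ≤ v i α)
    (hv_lim : ∀ i, Tendsto (fun α => v i α / α ^ 3) atTop (nhds (c i))) :
    ∀ k : Fin C,
      Tendsto
        (fun α =>
          Real.exp ((a k * α + b k) * (1 + π / 8 * v k α) ^ (-(1 : ℝ) / 2)) /
            ∑ i : Fin C,
              Real.exp ((a i * α + b i) * (1 + π / 8 * v i α) ^ (-(1 : ℝ) / 2)))
        atTop (nhds (1 / C)) := by
  intro k
  have exp_lim : ∀ i, Tendsto (fun α =>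
      Real.exp ((a i * α + b i) * (1 + π / 8 * v i α) ^ (-(1 : ℝ) / 2))) atTop (nhds 1) := by
    intro i
    simpa using (tendsto_affine_mul_rpow_neg_half_of_cubic (a := a i) (b := b i) (hc i)
      (hv_nonneg i) (hv_lim i)).rexp
  have sum_lim := tendsto_finsetSum Finset.univ fun i _ => exp_lim i
  rw [Finset.sum_const, Finset.card_univ, Fintype.card_fin, nsmul_one] at sum_lim
  exact (exp_lim k).div sum_lim (Nat.cast_ne_zero.mpr (by lia))
end

section
/- (Binary 1/√α confidence decay) Let a, b ∈ ℝ and let v: (0, ∞) → ℝ satisfy v(α) ≥ 0 for all large α and v(α)/α³ → c as α → ∞ for some c > 0. Define m(α) := a α + b, κ(α) := (1 + (π/8) v(α))^{−1/2}, and let s(t) := 1/(1 + e^{−t}) be the logistic sigmoid. Then s(m(α) κ(α)) → 1/2 as α → ∞, and moreover there exist M > 0 and β > 0 such that |s(m(α) κ(α)) − 1/2| ≤ M α^{−1/2} for all α ≥ β. -/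
open Filter Real

/-- The logistic sigmoid is `1/2`-Lipschitz at the origin. -/
lemma abs_logistic_sub_half_le (t : ℝ) :
    |1 / (1 + Real.exp (-t)) - 1 / 2| ≤ |t| / 2 := by
  have hE := Real.exp_pos (-t)
  have h1 : 1 - t ≤ Real.exp (-t) := by linarith [Real.add_one_le_exp (-t)]
  have h2 : (1 + t) * Real.exp (-t) ≤ 1 := by
    calc (1 + t) * Real.exp (-t) ≤ Real.exp t * Real.exp (-t) := by
          gcongr
          linarith [Real.add_one_le_exp t]
      _ = 1 := by rw [← Real.exp_add]; simp
  have hs : 1 / (1 + Real.exp (-t)) - 1 / 2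
      = (1 - Real.exp (-t)) / (2 * (1 + Real.exp (-t))) := by
    field_simp
    ring
  rw [hs, abs_div, abs_of_pos (by positivity : 0 < 2 * (1 + Real.exp (-t))),
    div_le_iff₀ (by positivity)]
  rcases le_total 0 t with ht | ht
  · have := mul_nonneg ht hE.le
    rw [abs_of_nonneg ht, abs_le]
    constructor <;> linarith
  · have := mul_nonneg (neg_nonneg.mpr ht) hE.le
    rw [abs_of_nonpos ht, abs_le]
    constructor <;> linarith

/-- An affine function divided by the square root of a function growing at least like `K α ^ 3`
decays at least like `1 / √α`. -/
lemma abs_affine_mul_rpow_neg_half_le {a b K w α : ℝ} (hK : 0 < K) (hα : 1 ≤ α)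
    (hw : K * α ^ 3 ≤ w) :
    |(a * α + b) * w ^ (-(1 : ℝ) / 2)|
      ≤ (|a| + |b|) * K ^ (-(1 : ℝ) / 2) * α ^ (-(1 : ℝ) / 2) := by
  have hα0 : 0 < α := one_pos.trans_le hα
  have hw0 : 0 < w := lt_of_lt_of_le (by positivity) hw
  have hm : |a * α + b| ≤ (|a| + |b|) * α := by
    calc |a * α + b| ≤ |a * α| + |b| := abs_add_le _ _
      _ ≤ |a| * α + |b| * α := by
          rw [abs_mul, abs_of_pos hα0]
          gcongr
          exact le_mul_of_one_le_right (abs_nonneg b) hα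
      _ = (|a| + |b|) * α := by ring
  have hpow : α * (α ^ 3) ^ (-(1 : ℝ) / 2) = α ^ (-(1 : ℝ) / 2) := by
    rw [← Real.rpow_natCast, ← Real.rpow_mul hα0.le]
    nth_rewrite 1 [← Real.rpow_one α]
    rw [← Real.rpow_add hα0]
    norm_num
  rw [abs_mul, abs_of_pos (Real.rpow_pos_of_pos hw0 _)]
  calc |a * α + b| * w ^ (-(1 : ℝ) / 2)
      ≤ (|a| + |b|) * α * (K * α ^ 3) ^ (-(1 : ℝ) / 2) := by
        gcongr ?_ * ?_
        exact Real.rpow_le_rpow_of_nonpos (by positivity) hw (by norm_num)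
    _ = (|a| + |b|) * K ^ (-(1 : ℝ) / 2) * α ^ (-(1 : ℝ) / 2) := by
        rw [Real.mul_rpow hK.le (by positivity), ← hpow]
        ring

/-- (Binary `1/√α` confidence decay) With `m(α) := a α + b`,
`κ(α) := (1 + (π/8) v(α))^{-1/2}` where `v(α) ≥ 0` for large `α` and `v(α)/α³ → c > 0`,
and `s(t) := 1/(1 + e^{-t})` the logistic sigmoid, the confidence `s(m(α) κ(α))` tends
to `1/2` as `α → ∞`, and there are `M > 0`, `β > 0` with
`|s(m(α) κ(α)) − 1/2| ≤ M α^{-1/2}` for all `α ≥ β`. -/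
theorem binary_confidence_decay (a b : ℝ) (v : ℝ → ℝ) (c : ℝ) (hc : 0 < c)
    (hv_nonneg : ∀ᶠ α in atTop, 0 ≤ v α)
    (hv_lim : Tendsto (fun α => v α / α ^ 3) atTop (nhds c)) :
    Tendsto
      (fun α => 1 / (1 + Real.exp (-((a * α + b) * (1 + π / 8 * v α) ^ (-(1 : ℝ) / 2)))))
      atTop (nhds (1 / 2)) ∧
    ∃ (M β : ℝ), 0 < M ∧ 0 < β ∧
      ∀ α : ℝ, β ≤ α →
        |1 / (1 + Real.exp (-((a * α + b) * (1 + π / 8 * v α) ^ (-(1 : ℝ) / 2)))) - 1 / 2|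
          ≤ M * α ^ (-(1 : ℝ) / 2) := by
  have hK : 0 < π / 8 * (c / 2) := by positivity
  obtain ⟨M, hM, hev⟩ : ∃ M : ℝ, 0 < M ∧ ∀ᶠ α : ℝ in atTop,
      |1 / (1 + Real.exp (-((a * α + b) * (1 + π / 8 * v α) ^ (-(1 : ℝ) / 2)))) - 1 / 2|
        ≤ M * α ^ (-(1 : ℝ) / 2) := by
    refine ⟨(|a| + |b|) * (π / 8 * (c / 2)) ^ (-(1 : ℝ) / 2) + 1, by positivity, ?_⟩
    filter_upwards [hv_lim.eventually_const_lt (half_lt_self hc), eventually_ge_atTop 1]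
      with α hlt hα
    have hα0 : 0 < α := one_pos.trans_le hα
    have hv : c / 2 * α ^ 3 ≤ v α := ((lt_div_iff₀ (by positivity)).mp hlt).le
    have hw : π / 8 * (c / 2) * α ^ 3 ≤ 1 + π / 8 * v α := by
      have := mul_le_mul_of_nonneg_left hv (by positivity : 0 ≤ π / 8)
      linarith
    have hbound := abs_affine_mul_rpow_neg_half_le (a := a) (b := b) hK hα hw
    have hpos := Real.rpow_pos_of_pos hα0 (-(1 : ℝ) / 2)
    have hsig := abs_logistic_sub_half_le ((a * α + b) * (1 + π / 8 * v α) ^ (-(1 : ℝ) / 2))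
    have := abs_nonneg ((a * α + b) * (1 + π / 8 * v α) ^ (-(1 : ℝ) / 2))
    linarith
  constructor
  · have hdecay : Tendsto (fun α : ℝ => M * α ^ (-(1 : ℝ) / 2)) atTop (nhds 0) := by
      have h := (tendsto_rpow_neg_atTop (by norm_num : (0 : ℝ) < 1 / 2)).const_mul M
      simpa only [mul_zero, neg_div] using h
    rw [tendsto_iff_norm_sub_tendsto_zero]
    exact squeeze_zero' (Eventually.of_forall fun _ => norm_nonneg _) hev hdecay
  · obtain ⟨β, hβ⟩ := eventually_atTop.mp hev
    exact ⟨M, max β 1, hM, by positivity, fun α hα => hβ α (le_of_max_le_left hα)⟩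
end
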